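/- Let ζ, u ∈ S_∞ and let k be a positive integer with u ≤_k ζ∘u. Then ℓ(ζ∘u) = ℓ(u) + |ζ|. -/

import Mathlib

/-- `S_∞`: a permutation of the positive integers lies in `S_∞` iff it
fixes all but finitely many integers. -/
def finSupp (w : Equiv.Perm ℕ+) : Prop := {i : ℕ+ | w i ≠ i}.Finite

/-- The length `ℓ(w) = #{(i,j) : i < j and w(i) > w(j)}`. -/
noncomputable def len (w : Equiv.Perm ℕ+) : ℕ :=
  {p : ℕ+ × ℕ+ | p.1 < p.2 ∧ w p.2 < w p.1}.ncard

/-- Cover relation of the `k`-Bruhat order: `w = u∘(a,b)` with `a ≤ k < b`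
and `ℓ(w) = ℓ(u) + 1`. -/
def kBruhatCover (k : ℕ) (u w : Equiv.Perm ℕ+) : Prop :=
  ∃ a b : ℕ+, (a : ℕ) ≤ k ∧ k < (b : ℕ) ∧ w = u * Equiv.swap a b ∧ len w = len u + 1

/-- The `k`-Bruhat order `≤_k`: reflexive–transitive closure of the cover relation. -/
def kBruhatLE (k : ℕ) : Equiv.Perm ℕ+ → Equiv.Perm ℕ+ → Prop :=
  Relation.ReflTransGen (kBruhatCover k)

/-- The rank `|ζ|` as an integer. -/
noncomputable def zlen (ζ : Equiv.Perm ℕ+) : ℤ :=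
  ({p : ℕ+ × ℕ+ | p.1 ∈ (⇑ζ) '' {α | α < ζ α} ∧ p.2 ∈ (⇑ζ) '' {β | ζ β < β} ∧ p.2 < p.1}.ncard : ℤ)
    - ({p : ℕ+ × ℕ+ | p.1 < ζ p.1 ∧ p.2 < ζ p.2 ∧ p.2 < p.1 ∧ ζ p.1 < ζ p.2}.ncard : ℤ)
    - ({p : ℕ+ × ℕ+ | ζ p.1 < p.1 ∧ ζ p.2 < p.2 ∧ p.2 < p.1 ∧ ζ p.1 < ζ p.2}.ncard : ℤ)
    - ({p : ℕ+ × ℕ+ | p.1 < ζ p.1 ∧ ζ p.2 < p.2 ∧ p.2 < p.1}.ncard : ℤ)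

/-- The inversion set of a permutation. -/
def invSet (w : Equiv.Perm ℕ+) : Set (ℕ+ × ℕ+) := {p | p.1 < p.2 ∧ w p.2 < w p.1}

theorem finSupp.exists_bound {w : Equiv.Perm ℕ+} (h : finSupp w) :
    ∃ N : ℕ+, ∀ n, N < n → w n = n := by
  obtain ⟨N, hN⟩ := h.bddAbove
  refine ⟨N, fun n hn => ?_⟩
  by_contra hne
  exact absurd (hN hne) (not_le.mpr hn)

theorem apply_le_iff_of_fixes_above {w : Equiv.Perm ℕ+} {N : ℕ+} (h : ∀ n, N < n → w n = n)
    (a : ℕ+) : w a ≤ N ↔ a ≤ N := by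
  constructor
  · intro hw
    by_contra ha
    rw [h a (not_le.mp ha)] at hw
    exact ha hw
  · intro ha
    by_contra hw
    have := w.injective (h _ (not_le.mp hw))
    exact hw (this.symm ▸ ha)

theorem finSupp.invSet_finite {w : Equiv.Perm ℕ+} (h : finSupp w) : (invSet w).Finite := by
  obtain ⟨N, hN⟩ := h.exists_bound
  refine ((Set.finite_Iic N).prod (Set.finite_Iic N)).subset ?_
  rintro ⟨i, j⟩ ⟨hij, hw⟩
  simp only [Set.mem_prod, Set.mem_Iic] at *
  have hj : j ≤ N := by
    by_contra hj
    rw [hN j (not_le.mp hj)] at hw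
    have hi : ¬ i ≤ N := fun hi =>
      hj (hw.le.trans ((apply_le_iff_of_fixes_above hN i).mpr hi))
    rw [hN i (not_le.mp hi)] at hw
    exact absurd hw hij.not_gt
  exact ⟨hij.le.trans hj, hj⟩

theorem finSupp.mul_swap {u : Equiv.Perm ℕ+} (h : finSupp u) (a b : ℕ+) :
    finSupp (u * Equiv.swap a b) := by
  refine (h.union (Set.toFinite {a, b})).subset ?_
  intro i hi
  by_cases hia : i = a
  · simp [hia]
  by_cases hib : i = b
  · simp [hib]
  left
  simpa [Equiv.swap_apply_of_ne_of_ne hia hib] using hi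

/-- Apply the transposition `(i,j)` to a pair of positions, unless this reverses their order. -/
def swapPair (i j : ℕ+) (p : ℕ+ × ℕ+) : ℕ+ × ℕ+ :=
  if Equiv.swap i j p.1 < Equiv.swap i j p.2 then (Equiv.swap i j p.1, Equiv.swap i j p.2) else p

theorem swapPair_swapPair {i j : ℕ+} {p : ℕ+ × ℕ+} (hp : p.1 < p.2) :
    swapPair i j (swapPair i j p) = p := by
  by_cases h : Equiv.swap i j p.1 < Equiv.swap i j p.2
  · simp [swapPair, h, hp]
  · simp [swapPair, h]

theorem swapPair_mem_invSet {u : Equiv.Perm ℕ+} {i j : ℕ+} (hij : i < j) (hu : u i < u j)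
    {p : ℕ+ × ℕ+} (hp : p ∈ invSet u) : swapPair i j p ∈ invSet (u * Equiv.swap i j) := by
  obtain ⟨p, q⟩ := p
  obtain ⟨hpq, hlt⟩ := hp
  by_cases h : Equiv.swap i j p < Equiv.swap i j q
  · simpa [swapPair, h, invSet] using hlt
  · simp only [swapPair, h, if_false, invSet, Set.mem_ofPred_eq, Equiv.Perm.mul_apply]
    refine ⟨hpq, ?_⟩
    simp only [Equiv.swap_apply_def] at h ⊢
    grind

theorem len_add_ncard_le {u : Equiv.Perm ℕ+} (hfin : finSupp u) {i j : ℕ+} (hij : i < j)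
    (hu : u i < u j) {T : Set (ℕ+ × ℕ+)} (hT : T ⊆ invSet (u * Equiv.swap i j))
    (hT' : ∀ p ∈ T, swapPair i j p ∉ invSet u) :
    len u + T.ncard ≤ len (u * Equiv.swap i j) := by
  have hf := (hfin.mul_swap i j).invSet_finite
  have hinj : Set.InjOn (swapPair i j) (invSet u) := fun p hp q hq h => by
    rw [← swapPair_swapPair (i := i) (j := j) hp.1, h, swapPair_swapPair hq.1]
  have hsub : swapPair i j '' invSet u ∪ T ⊆ invSet (u * Equiv.swap i j) := by
    refine Set.union_subset ?_ hT
    rintro _ ⟨p, hp, rfl⟩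
    exact swapPair_mem_invSet hij hu hp
  have hdisj : Disjoint (swapPair i j '' invSet u) T := by
    rw [Set.disjoint_left]
    rintro _ ⟨p, hp, rfl⟩ hmem
    exact hT' _ hmem (by rwa [swapPair_swapPair hp.1])
  have := Set.ncard_le_ncard hsub hf
  rw [Set.ncard_union_eq hdisj (hfin.invSet_finite.image _) (hf.subset hT),
    hinj.ncard_image] at this
  exact this

theorem len_lt_len_mul_swap {u : Equiv.Perm ℕ+} (hfin : finSupp u) {i j : ℕ+} (hij : i < j)
    (hu : u i < u j) : len u < len (u * Equiv.swap i j) := by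
  have := len_add_ncard_le hfin hij hu (T := {(i, j)})
    (by simp [invSet, hij, hu]) (by simp [swapPair, invSet, hij.not_gt, hu.le])
  rw [Set.ncard_singleton] at this
  omega

theorem len_add_two_le_len_mul_swap {u : Equiv.Perm ℕ+} (hfin : finSupp u) {i j c : ℕ+}
    (hic : i < c) (hcj : c < j) (huic : u i < u c) (hucj : u c < u j) :
    len u + 2 ≤ len (u * Equiv.swap i j) := by
  have hij := hic.trans hcj
  have hu := huic.trans hucj
  have hs : Equiv.swap i j c = c := Equiv.swap_apply_of_ne_of_ne hic.ne' hcj.ne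
  have := len_add_ncard_le hfin hij hu (T := {(i, j), (i, c)})
    (by
      rintro p (rfl | rfl)
      · simp [invSet, hij, hu]
      · simp [invSet, hic, hs, hucj])
    (by
      rintro p (rfl | rfl)
      · simp [swapPair, invSet, hij.not_gt, hu.not_gt]
      · simp [swapPair, invSet, hs, hcj.not_gt, huic.not_gt])
  rwa [Set.ncard_pair (by simp [hcj.ne'])] at this

/-- Every length-additive transposition `(i,j)` with `i < j` increases the value at `i`, and no
intermediate position has an intermediate value. -/
theorem lt_and_not_between_of_len_mul_swap {u : Equiv.Perm ℕ+} (hfin : finSupp u) {i j : ℕ+}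
    (hij : i < j) (h : len (u * Equiv.swap i j) = len u + 1) :
    u i < u j ∧ ∀ c, i < c → c < j → ¬ (u i < u c ∧ u c < u j) := by
  refine ⟨?_, fun c hic hcj ⟨h1, h2⟩ => ?_⟩
  · by_contra hle
    have hlt : u j < u i := lt_of_le_of_ne (not_lt.mp hle) (u.injective.ne hij.ne')
    have := len_lt_len_mul_swap (hfin.mul_swap i j) hij (by simpa using hlt)
    rw [mul_assoc, Equiv.swap_mul_self, mul_one] at this
    omega
  · have := len_add_two_le_len_mul_swap hfin hic hcj h1 h2
    omega

/-- Necessary conditions for `u ≤_k w`: values at positions `≤ k` go up, the others go down,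
and non-inversions on the same side of `k` are preserved. -/
structure KBruhatNecessary (k : ℕ) (u w : Equiv.Perm ℕ+) : Prop where
  le_apply : ∀ i : ℕ+, (i : ℕ) ≤ k → u i ≤ w i
  apply_le : ∀ i : ℕ+, k < (i : ℕ) → w i ≤ u i
  lt_of_lt : ∀ i j : ℕ+, i < j → ((j : ℕ) ≤ k ∨ k < (i : ℕ)) → u i < u j → w i < w j

theorem kBruhatCover.necessary {k : ℕ} {u w : Equiv.Perm ℕ+} (hfin : finSupp u)
    (h : kBruhatCover k u w) : KBruhatNecessary k u w := by
  obtain ⟨a, b, ha, hb, rfl, hlen⟩ := h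
  have hab : a < b := by
    rw [← PNat.coe_lt_coe]
    omega
  obtain ⟨hlt, hbtw⟩ := lt_and_not_between_of_len_mul_swap hfin hab hlen
  refine ⟨fun i hi => ?_, fun i hi => ?_, fun i j hij hk hu => ?_⟩
  · have : i ≠ b := by rintro rfl; omega
    simp only [Equiv.Perm.mul_apply, Equiv.swap_apply_def]
    grind
  · have : i ≠ a := by rintro rfl; omega
    simp only [Equiv.Perm.mul_apply, Equiv.swap_apply_def]
    grind
  · have hinj : ∀ c d, u c = u d → c = d := fun c d hcd => u.injective hcd
    simp only [Equiv.Perm.mul_apply, Equiv.swap_apply_def]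
    rw [← PNat.coe_lt_coe] at hij
    rcases hk with hk | hk
    · have hib : i ≠ b := by rintro rfl; omega
      have hjb : j ≠ b := by rintro rfl; omega
      have hjb' : j < b := by rw [← PNat.coe_lt_coe]; omega
      rw [PNat.coe_lt_coe] at hij
      by_cases hia : i = a
      · subst hia
        have h1 := hbtw j hij hjb'
        have h2 := hinj j b
        grind
      · grind
    · have hia : i ≠ a := by rintro rfl; omega
      have hja : j ≠ a := by rintro rfl; omega
      have hai : a < i := by rw [← PNat.coe_lt_coe]; omega
      rw [PNat.coe_lt_coe] at hij
      by_cases hjb : j = b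
      · subst hjb
        have h1 := hbtw i hai hij
        have h2 := hinj i a
        grind
      · grind

theorem kBruhatLE.necessary {k : ℕ} {u w : Equiv.Perm ℕ+} (hfin : finSupp u)
    (h : kBruhatLE k u w) : finSupp w ∧ KBruhatNecessary k u w := by
  induction h with
  | refl => exact ⟨hfin, fun _ _ => le_rfl, fun _ _ => le_rfl, fun _ _ _ _ h => h⟩
  | tail _ hc ih =>
    obtain ⟨hf, hn⟩ := ih
    have hn' := hc.necessary hf
    refine ⟨?_, fun i hi => (hn.le_apply i hi).trans (hn'.le_apply i hi),
      fun i hi => (hn'.apply_le i hi).trans (hn.apply_le i hi),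
      fun i j hij hk hu => hn'.lt_of_lt i j hij hk (hn.lt_of_lt i j hij hk hu)⟩
    obtain ⟨a, b, -, -, rfl, -⟩ := hc
    exact hf.mul_swap a b

open Classical in
theorem ncard_eq_sum_sum {S : Set (ℕ+ × ℕ+)} {F : Finset ℕ+}
    (h : ∀ a b, (a, b) ∈ S → a ∈ F ∧ b ∈ F) :
    (S.ncard : ℤ) = ∑ a ∈ F, ∑ b ∈ F, if (a, b) ∈ S then 1 else 0 := by
  have hS : S = ↑((F ×ˢ F).filter (· ∈ S)) := by
    ext ⟨a, b⟩
    simp only [Finset.coe_filter, Finset.mem_product, Set.mem_ofPred_eq]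
    exact ⟨fun hp => ⟨h a b hp, hp⟩, fun hp => hp.2⟩
  rw [← Finset.sum_product' F F (fun a b => if (a, b) ∈ S then (1 : ℤ) else 0)]
  conv_lhs => rw [hS, Set.ncard_coe_finset]
  simp

/-- Inversions of `ζ∘u`, indexed by values of `u` instead of positions. -/
theorem len_mul_eq_ncard (ζ u : Equiv.Perm ℕ+) :
    len (ζ * u) = {p : ℕ+ × ℕ+ | u⁻¹ p.1 < u⁻¹ p.2 ∧ ζ p.2 < ζ p.1}.ncard := by
  rw [len, ← Set.ncard_image_of_injective _ (u.prodCongr u).injective]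
  congr 1
  ext ⟨a, b⟩
  constructor
  · rintro ⟨⟨i, j⟩, ⟨hij, hw⟩, h⟩
    simp only [Equiv.prodCongr_apply, Prod.map_apply, Prod.mk.injEq] at h
    obtain ⟨rfl, rfl⟩ := h
    simpa using ⟨hij, hw⟩
  · rintro ⟨h1, h2⟩
    exact ⟨(u⁻¹ a, u⁻¹ b), ⟨h1, by simpa using h2⟩, by simp⟩

theorem ncard_image_up_down (ζ : Equiv.Perm ℕ+) :
    {p : ℕ+ × ℕ+ | p.1 ∈ (⇑ζ) '' {α | α < ζ α} ∧ p.2 ∈ (⇑ζ) '' {β | ζ β < β} ∧ p.2 < p.1}.ncard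
      = {p : ℕ+ × ℕ+ | p.1 < ζ p.1 ∧ ζ p.2 < p.2 ∧ ζ p.2 < ζ p.1}.ncard := by
  rw [← Set.ncard_image_of_injective {p : ℕ+ × ℕ+ | p.1 < ζ p.1 ∧ _} (ζ.prodCongr ζ).injective]
  congr 1
  ext ⟨x, y⟩
  constructor
  · rintro ⟨⟨a, ha, rfl⟩, ⟨b, hb, rfl⟩, h⟩
    exact ⟨(a, b), ⟨ha, hb, h⟩, rfl⟩
  · rintro ⟨⟨a, b⟩, ⟨ha, hb, h⟩, he⟩
    simp only [Equiv.prodCongr_apply, Prod.map_apply, Prod.mk.injEq] at he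
    obtain ⟨rfl, rfl⟩ := he
    exact ⟨⟨a, ha, rfl⟩, ⟨b, hb, rfl⟩, h⟩

/-- Around a fixed point `c` of `ζ`, as many values cross `c` downwards as upwards. -/
theorem sum_crossing_eq_zero {ζ : Equiv.Perm ℕ+} {F : Finset ℕ+} (hF : ∀ a, ζ a ∈ F ↔ a ∈ F)
    {c : ℕ+} (hc : ζ c = c) :
    ∑ b ∈ F, ((if ζ b < c ∧ c < b then (1 : ℤ) else 0) - if b < c ∧ c < ζ b then 1 else 0) = 0 := by
  have hpt : ∀ b, ((if ζ b < c ∧ c < b then (1 : ℤ) else 0) - if b < c ∧ c < ζ b then 1 else 0)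
      = (if c < b then 1 else 0) - if c < ζ b then 1 else 0 := fun b => by
    have h1 : ζ b = c → b = c := fun h => ζ.injective (h.trans hc.symm)
    have h2 : b = c → ζ b = c := fun h => h ▸ hc
    grind
  simp only [hpt, Finset.sum_sub_distrib]
  rw [sub_eq_zero]
  exact (Finset.sum_equiv ζ (fun a => (hF a).symm) fun _ _ => rfl).symm

/-- The contribution of the pair of values `(a,b)`, with images `(x,y)` and positions `(p,q)`,
to `ℓ(ζ∘u) - ℓ(u) - |ζ|` comes from fixed points only. -/
theorem pair_contribution {k a b x y p q : ℕ}
    (hpq : p = q ↔ a = b) (hxy : x = y ↔ a = b)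
    (ha : p ≤ k → a ≤ x) (ha' : k < p → x ≤ a) (hb : q ≤ k → b ≤ y) (hb' : k < q → y ≤ b)
    (hab : p < q → (q ≤ k ∨ k < p) → a < b → x < y)
    (hba : q < p → (p ≤ k ∨ k < q) → b < a → y < x) :
    (if p < q ∧ y < x then (1 : ℤ) else 0) - (if p < q ∧ b < a then 1 else 0)
      - ((if a < x ∧ y < b ∧ y < x then 1 else 0) - (if a < x ∧ b < y ∧ b < a ∧ x < y then 1 else 0)
        - (if x < a ∧ y < b ∧ b < a ∧ x < y then 1 else 0) - (if a < x ∧ y < b ∧ b < a then 1 else 0))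
    = (if x = a ∧ p ≤ k then (if y < a ∧ a < b then 1 else 0) - (if b < a ∧ a < y then 1 else 0)
        else 0)
      - (if y = b ∧ k < q then (if x < b ∧ b < a then 1 else 0) - (if a < b ∧ b < x then 1 else 0)
        else 0) := by
  rcases le_or_gt p k with hp | hp <;> rcases le_or_gt q k with hq | hq
  · have hax := ha hp
    have hby := hb hq
    replace hab := fun h => hab h (.inl hq)
    replace hba := fun h => hba h (.inl hp)
    clear ha ha' hb hb'
    simp only [hax.not_gt, hby.not_gt, hp, hq.not_gt, false_and, and_false, if_false, and_true]
    split_ifs <;> omega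
  · have hax := ha hp
    have hyb := hb' hq
    have hlt := hp.trans_lt hq
    clear ha ha' hb hb' hab hba hpq
    simp only [hax.not_gt, hyb.not_gt, hp, hq, hlt, false_and, and_false, if_false, and_true,
      true_and]
    split_ifs <;> omega
  · have hxa := ha' hp
    have hby := hb hq
    have hlt := (hq.trans_lt hp).not_gt
    simp [hxa.not_gt, hby.not_gt, hp.not_ge, hq.not_gt, hlt]
  · have hxa := ha' hp
    have hyb := hb' hq
    replace hab := fun h => hab h (.inr hp)
    replace hba := fun h => hba h (.inr hq)
    clear ha ha' hb hb'
    simp only [hxa.not_gt, hyb.not_gt, hp.not_ge, hq, false_and, and_false, if_false, and_true]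
    split_ifs <;> omega

/-- Lemma 3.2.1: if `u ≤_k ζ∘u`, then `ℓ(ζ∘u) = ℓ(u) + |ζ|`. -/
theorem stmt6 (k : ℕ) (hk : 0 < k) (ζ u : Equiv.Perm ℕ+)
    (hζ : finSupp ζ) (hu : finSupp u)
    (h : kBruhatLE k u (ζ * u)) :
    (len (ζ * u) : ℤ) = (len u : ℤ) + zlen ζ := by
  classical
  obtain ⟨-, hn⟩ := h.necessary hu
  obtain ⟨M, hM⟩ := hζ.exists_bound
  obtain ⟨M', hM'⟩ := hu.exists_bound
  set N := max M M'
  have hζN : ∀ n, N < n → ζ n = n := fun n hn => hM n ((le_max_left _ _).trans_lt hn)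
  have huN : ∀ n, N < n → u⁻¹ n = n := fun n hn => by
    rw [Equiv.Perm.inv_eq_iff_eq, hM' n ((le_max_right _ _).trans_lt hn)]
  have hmoved : ∀ a, ζ a ≠ a → a ∈ Finset.Iic N := fun a ha => by
    rw [Finset.mem_Iic]
    by_contra h
    exact ha (hζN a (not_le.mp h))
  have hlen : ∀ ξ : Equiv.Perm ℕ+, (∀ n, N < n → ξ n = n) → ∀ a b : ℕ+,
      (a, b) ∈ {p : ℕ+ × ℕ+ | u⁻¹ p.1 < u⁻¹ p.2 ∧ ξ p.2 < ξ p.1} →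
      a ∈ Finset.Iic N ∧ b ∈ Finset.Iic N := by
    rintro ξ hξ a b ⟨h1, h2⟩
    simp only [Finset.mem_Iic] at *
    have hξa := apply_le_iff_of_fixes_above hξ a
    have hua := apply_le_iff_of_fixes_above huN a
    have hub := apply_le_iff_of_fixes_above huN b
    have := hξ a
    have := hξ b
    have := huN a
    have := huN b
    grind
  have key : (len (ζ * u) : ℤ) - len u - zlen ζ = 0 := by
    rw [zlen, ncard_image_up_down, len_mul_eq_ncard ζ u, ← one_mul u, len_mul_eq_ncard 1 u, one_mul,
      ncard_eq_sum_sum (hlen ζ hζN), ncard_eq_sum_sum (hlen 1 fun _ _ => rfl),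
      ncard_eq_sum_sum (F := Finset.Iic N) fun a b hab => ⟨hmoved a hab.1.ne', hmoved b hab.2.1.ne⟩,
      ncard_eq_sum_sum (F := Finset.Iic N) fun a b hab => ⟨hmoved a hab.1.ne', hmoved b hab.2.1.ne'⟩,
      ncard_eq_sum_sum (F := Finset.Iic N) fun a b hab => ⟨hmoved a hab.1.ne, hmoved b hab.2.1.ne⟩,
      ncard_eq_sum_sum (F := Finset.Iic N) fun a b hab => ⟨hmoved a hab.1.ne', hmoved b hab.2.1.ne⟩]
    simp only [← Finset.sum_sub_distrib]
    have hF : ∀ a, ζ a ∈ Finset.Iic N ↔ a ∈ Finset.Iic N := by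
      simpa using apply_le_iff_of_fixes_above hζN
    have hle : ∀ a, ((u⁻¹ a : ℕ+) : ℕ) ≤ k → a ≤ ζ a := fun a ha => by
      simpa using hn.le_apply _ ha
    have hge : ∀ a, k < ((u⁻¹ a : ℕ+) : ℕ) → ζ a ≤ a := fun a ha => by
      simpa using hn.apply_le _ ha
    have hlt : ∀ a b, u⁻¹ a < u⁻¹ b → (((u⁻¹ b : ℕ+) : ℕ) ≤ k ∨ k < ((u⁻¹ a : ℕ+) : ℕ)) →
        a < b → ζ a < ζ b := fun a b h1 h2 h3 => by
      simpa using hn.lt_of_lt _ _ h1 h2 (by simpa using h3)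
    have hpair := fun a b : ℕ+ => pair_contribution (k := k) (a := a) (b := b) (x := ζ a)
      (y := ζ b) (p := (u⁻¹ a : ℕ+)) (q := (u⁻¹ b : ℕ+))
      (by simp) (by simp) (hle a) (hge a) (hle b) (hge b) (hlt a b) (hlt b a)
    simp only [PNat.coe_lt_coe, PNat.coe_inj] at hpair
    refine (Finset.sum_congr rfl fun a _ => Finset.sum_congr rfl fun b _ =>
      Eq.trans (by congr!) (hpair a b)).trans ?_
    simp only [Finset.sum_sub_distrib]
    rw [sub_eq_zero]
    trans (0 : ℤ)
    · refine Finset.sum_eq_zero fun a _ => ?_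
      by_cases hc : ζ a = a ∧ ((u⁻¹ a : ℕ+) : ℕ) ≤ k
      · simpa only [if_pos hc] using sum_crossing_eq_zero hF hc.1
      · simp only [if_neg hc, Finset.sum_const_zero]
    · rw [Finset.sum_comm]
      refine (Finset.sum_eq_zero fun b _ => ?_).symm
      by_cases hc : ζ b = b ∧ k < ((u⁻¹ b : ℕ+) : ℕ)
      · simpa only [if_pos hc] using sum_crossing_eq_zero hF hc.1
      · simp only [if_neg hc, Finset.sum_const_zero]
  linarith
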